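/- (Weak propagation property of homological chordality) Let Δ be an abstract simplicial complex without missing faces of dimension > k, for some k ≥ 1. Then the following are equivalent: (A) Δ is resolution i-chordal for every i with k ≤ i ≤ 2k−1; (B) Δ is resolution i-chordal for every i ≥ k (i.e., Δ is k-Leray). -/

import Mathlib

open MvPolynomial

open MvPolynomial

/-- An abstract simplicial complex on the vertex set `Fin n`:
a collection of finite subsets closed under taking subsets. -/
def IsComplex {n : ℕ} (Δ : Set (Finset (Fin n))) : Prop :=
  ∀ σ ∈ Δ, ∀ τ ⊆ σ, τ ∈ Δ

/-- The vertex set `Δ^(0)` of a simplicial complex. -/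
def verts {n : ℕ} (Δ : Set (Finset (Fin n))) : Set (Fin n) := {v | {v} ∈ Δ}

/-- The partial derivative `∂/∂xᵢ` as a linear endomorphism of `ℝ[x₁,…,xₙ]`. -/
noncomputable def pd {n : ℕ} (i : Fin n) : Module.End ℝ (MvPolynomial (Fin n) ℝ) :=
  (pderiv i).toLinearMap

/-- The constant coefficient differential operator `(x^a)^∨ = ∏ᵢ (∂/∂xᵢ)^(aᵢ)`. -/
noncomputable def monDiff {n : ℕ} (a : Fin n →₀ ℕ) : Module.End ℝ (MvPolynomial (Fin n) ℝ) :=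
  ((List.finRange n).map fun i => pd i ^ a i).prod

/-- The stress space `S̃(Δ)`: polynomials annihilated by `q^∨` for every `q` in the
nonface ideal `I_Δ` (equivalently, by `(x^a)^∨` for every monomial generator `x^a` of `I_Δ`). -/
noncomputable def tStress {n : ℕ} (Δ : Set (Finset (Fin n))) :
    Submodule ℝ (MvPolynomial (Fin n) ℝ) :=
  ⨅ a ∈ {a : Fin n →₀ ℕ | a.support ∉ Δ}, LinearMap.ker (monDiff a)

/-- A linear differential `Σᵢ cᵢ ∂/∂xᵢ`. -/
noncomputable def linDiff {n : ℕ} (c : Fin n → ℝ) : Module.End ℝ (MvPolynomial (Fin n) ℝ) :=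
  ∑ i, c i • pd i

/-- The canonical differential `δ = Σᵢ ∂/∂xᵢ`. -/
noncomputable def canDiff (n : ℕ) : Module.End ℝ (MvPolynomial (Fin n) ℝ) :=
  linDiff fun _ => (1 : ℝ)

/-- The coordinate differential `θⱼ = Σᵢ (vᵢ)ⱼ ∂/∂xᵢ` of a geometric simplicial complex. -/
noncomputable def coordDiff {n d : ℕ} (V : Fin n → Fin d → ℝ) (j : Fin d) :
    Module.End ℝ (MvPolynomial (Fin n) ℝ) :=
  linDiff fun i => V i j

/-- The stress space `S(Δ)` of a geometric simplicial complex with vertex coordinates `V`. -/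
noncomputable def stress {n d : ℕ} (V : Fin n → Fin d → ℝ) (Δ : Set (Finset (Fin n))) :
    Submodule ℝ (MvPolynomial (Fin n) ℝ) :=
  tStress Δ ⊓ ⨅ j : Fin d, LinearMap.ker (coordDiff V j)

/-- The degree-`k` graded piece `S_k(Δ)` of the stress space. -/
noncomputable def stressK {n d : ℕ} (V : Fin n → Fin d → ℝ) (Δ : Set (Finset (Fin n)))
    (k : ℕ) : Submodule ℝ (MvPolynomial (Fin n) ℝ) :=
  stress V Δ ⊓ homogeneousSubmodule (Fin n) ℝ k

/-- A geometric simplicial complex in `ℝ^d` is proper if the coordinates of each face of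
dimension `< d` are linearly independent. -/
def IsProper {n d : ℕ} (V : Fin n → Fin d → ℝ) (Δ : Set (Finset (Fin n))) : Prop :=
  ∀ σ ∈ Δ, σ.card ≤ d → LinearIndependent ℝ (fun i : {x // x ∈ σ} => V i.1)

/-- The star of a face. -/
def cStar {n : ℕ} (Δ : Set (Finset (Fin n))) (σ : Finset (Fin n)) : Set (Finset (Fin n)) :=
  {τ ∈ Δ | σ ∪ τ ∈ Δ}

/-- The star of a vertex. -/
def vStar {n : ℕ} (Δ : Set (Finset (Fin n))) (v : Fin n) : Set (Finset (Fin n)) :=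
  cStar Δ {v}

/-- The boundary `∂St_v Δ` of the star of a vertex: faces of the star not containing `v`. -/
def vStarBd {n : ℕ} (Δ : Set (Finset (Fin n))) (v : Fin n) : Set (Finset (Fin n)) :=
  {τ ∈ vStar Δ v | v ∉ τ}

/-- The link of a face. -/
def lk {n : ℕ} (Δ : Set (Finset (Fin n))) (σ : Finset (Fin n)) : Set (Finset (Fin n)) :=
  {τ | Disjoint σ τ ∧ σ ∪ τ ∈ Δ}

/-- The vertex set `γ^(0)` of the support of a stress `γ`. -/
noncomputable def stressVerts {n : ℕ} (γ : MvPolynomial (Fin n) ℝ) : Finset (Fin n) :=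
  γ.support.biUnion fun a => a.support

/-- `g_k = dim S_k − dim S_{k−1}` (with `S_{−1} = 0`). -/
noncomputable def gnum {n d : ℕ} (V : Fin n → Fin d → ℝ) (Δ : Set (Finset (Fin n)))
    (k : ℕ) : ℤ :=
  (Module.finrank ℝ ↥(stressK V Δ k) : ℤ) -
    if k = 0 then 0 else (Module.finrank ℝ ↥(stressK V Δ (k - 1)) : ℤ)

/-- The homogenizing embedding `ℝ^d → ℝ^d × {1} ⊆ ℝ^{d+1}` applied to vertex coordinates. -/
noncomputable def homV {n d : ℕ} (p : Fin n → Fin d → ℝ) : Fin n → Fin (d + 1) → ℝ :=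
  fun i => Fin.snoc (p i) 1

/-- `Δ` is the boundary complex of the simplicial `d`-polytope `conv{p 1, …, p n}`:
the polytope is full-dimensional, every `p i` is a vertex, the faces of `Δ` are exactly the
vertex sets cut out by supporting hyperplanes, and every proper face is a simplex. -/
def IsSimplicialPolytopeBoundary {n d : ℕ} (p : Fin n → Fin d → ℝ)
    (Δ : Set (Finset (Fin n))) : Prop :=
  affineSpan ℝ (Set.range p) = ⊤ ∧
  (∀ i, p i ∉ convexHull ℝ (p '' {j | j ≠ i})) ∧
  (∀ σ ∈ Δ, AffineIndependent ℝ (fun i : {x // x ∈ σ} => p i.1)) ∧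
  (∀ σ : Finset (Fin n), σ ∈ Δ ↔
    ∃ (f : (Fin d → ℝ) →ₗ[ℝ] ℝ) (c : ℝ),
      (∃ i, f (p i) < c) ∧ (∀ i, f (p i) ≤ c) ∧ (∀ i, f (p i) = c ↔ i ∈ σ))

/-- The simplicial boundary operator (with real coefficients), on the free module spanned by
all finite subsets of `Fin n`; the empty set plays the role of the `(−1)`-face, so that the
associated homology is reduced. -/
noncomputable def bdry {n : ℕ} : (Finset (Fin n) →₀ ℝ) →ₗ[ℝ] (Finset (Fin n) →₀ ℝ) :=
  Finsupp.lsum ℝ fun σ => LinearMap.toSpanSingleton ℝ _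
    (∑ i ∈ σ, ((-1 : ℝ) ^ (σ.filter (· < i)).card) • Finsupp.single (σ.erase i) (1 : ℝ))

/-- The space of simplicial `k`-chains of `Δ` (spanned by faces of `Δ` of dimension `k`). -/
noncomputable def chains {n : ℕ} (Δ : Set (Finset (Fin n))) (k : ℤ) :
    Submodule ℝ (Finset (Fin n) →₀ ℝ) :=
  Finsupp.supported ℝ ℝ {σ | σ ∈ Δ ∧ (σ.card : ℤ) = k + 1}

/-- Reduced simplicial `k`-cycles of `Δ`. -/
noncomputable def cycles {n : ℕ} (Δ : Set (Finset (Fin n))) (k : ℤ) :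
    Submodule ℝ (Finset (Fin n) →₀ ℝ) :=
  chains Δ k ⊓ LinearMap.ker bdry

/-- Simplicial `k`-boundaries of `Δ`. -/
noncomputable def bdries {n : ℕ} (Δ : Set (Finset (Fin n))) (k : ℤ) :
    Submodule ℝ (Finset (Fin n) →₀ ℝ) :=
  Submodule.map bdry (chains Δ (k + 1))

/-- The reduced Betti number `β̃_k(Δ)` (with real coefficients). -/
noncomputable def rBetti {n : ℕ} (Δ : Set (Finset (Fin n))) (k : ℤ) : ℕ :=
  Module.finrank ℝ ↥(cycles Δ k) - Module.finrank ℝ ↥(bdries Δ k)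

/-- The induced subcomplex `Δ_W` on a vertex set `W`. -/
def induced {n : ℕ} (Δ : Set (Finset (Fin n))) (W : Finset (Fin n)) : Set (Finset (Fin n)) :=
  {σ ∈ Δ | σ ⊆ W}

/-- The vertex set of the support of a simplicial chain. -/
def chainVerts {n : ℕ} (c : Finset (Fin n) →₀ ℝ) : Finset (Fin n) :=
  c.support.biUnion id

/-- `Δ` is resolution `k`-chordal: every `k`-cycle `z` admits a resolution, i.e. a
`(k+1)`-chain `c` with `∂c = z` and `c^(0) = z^(0)`. -/
def ResolutionChordal {n : ℕ} (Δ : Set (Finset (Fin n))) (k : ℤ) : Prop :=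
  ∀ z ∈ cycles Δ k, ∃ c ∈ chains Δ (k + 1), bdry c = z ∧ chainVerts c = chainVerts z

/-- `(Δ, ω)` is toric `k`-chordal: `ω : S_{k+1}(Δ) → S_k(Δ)` is surjective and
`ω : S_k(Δ) → S_{k−1}(Δ)` is injective. -/
def ToricChordal {n d : ℕ} (V : Fin n → Fin d → ℝ) (Δ : Set (Finset (Fin n)))
    (ω : Module.End ℝ (MvPolynomial (Fin n) ℝ)) (k : ℕ) : Prop :=
  (∀ γ ∈ stressK V Δ k, ∃ γ' ∈ stressK V Δ (k + 1), ω γ' = γ) ∧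
  (∀ γ ∈ stressK V Δ k, ω γ = 0 → γ = 0)

/-- `(Δ, ω)` is weakly toric `k`-chordal: `ω : S_k(St_v Δ) → S_{k−1}(St_v Δ)` is injective
for every vertex `v` of `Δ`. -/
def WeaklyToricChordal {n d : ℕ} (V : Fin n → Fin d → ℝ) (Δ : Set (Finset (Fin n)))
    (ω : Module.End ℝ (MvPolynomial (Fin n) ℝ)) (k : ℕ) : Prop :=
  ∀ v ∈ verts Δ, ∀ γ ∈ stressK V (vStar Δ v) k, ω γ = 0 → γ = 0

/-- A missing face of `Δ`: a nonface all of whose proper subsets are faces. -/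
def IsMissingFace {n : ℕ} (Δ : Set (Finset (Fin n))) (σ : Finset (Fin n)) : Prop :=
  σ ∉ Δ ∧ ∀ τ ⊂ σ, τ ∈ Δ

/-- Representatives of relative `k`-stresses of the relative complex `(Δ', Γ)`:
homogeneous degree-`k` elements of `S̃(Δ')` whose image under each coordinate differential
lies in `S̃(Γ)`.  The relative stress space `S_k(Δ', Γ)` is the quotient of this space by
(the degree-`k` part of) `S̃(Γ)`. -/
noncomputable def relStressK {n d : ℕ} (V : Fin n → Fin d → ℝ)
    (Δ' Γ : Set (Finset (Fin n))) (k : ℕ) : Submodule ℝ (MvPolynomial (Fin n) ℝ) :=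
  tStress Δ' ⊓ homogeneousSubmodule (Fin n) ℝ k ⊓
    ⨅ j : Fin d, (tStress Γ).comap (coordDiff V j)

/-- A shelling of a pure `(d−1)`-dimensional simplicial complex: a linear order on the facets
such that the intersection of each facet with the union of all subsequent facets is a pure
`(d−2)`-dimensional complex or empty. -/
def IsShelling {n : ℕ} (Δ : Set (Finset (Fin n))) (d : ℕ) (L : List (Finset (Fin n))) : Prop :=
  L.Nodup ∧ (∀ σ, σ ∈ L ↔ σ ∈ Δ ∧ σ.card = d) ∧
  (∀ σ ∈ Δ, ∃ F ∈ L, σ ⊆ F) ∧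
  ∀ (i : ℕ) (hi : i < L.length) (τ : Finset (Fin n)), τ ⊆ L.get ⟨i, hi⟩ →
    (∃ (j : ℕ) (hj : j < L.length), i < j ∧ τ ⊆ L.get ⟨j, hj⟩) →
    ∃ ρ, τ ⊆ ρ ∧ ρ ⊆ L.get ⟨i, hi⟩ ∧ ρ.card = d - 1 ∧
      ∃ (j : ℕ) (hj : j < L.length), i < j ∧ ρ ⊆ L.get ⟨j, hj⟩

/-- The degree-`k` graded piece of the stress space `S̃(Δ)`. -/
noncomputable def tStressK {n : ℕ} (Δ : Set (Finset (Fin n))) (k : ℕ) :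
    Submodule ℝ (MvPolynomial (Fin n) ℝ) :=
  tStress Δ ⊓ homogeneousSubmodule (Fin n) ℝ k

/-- A sequence `θ` of linear differentials is regular up to degree `k` on `S̃(Δ)`: each
`θ_j` maps the degree-`(i+1)` part of the common kernel of `θ_1, …, θ_{j−1}` in `S̃(Δ)` onto
the degree-`i` part, for every `i ≤ k`. -/
def RegularUpTo {n : ℕ} (Δ : Set (Finset (Fin n)))
    (θ : List (Module.End ℝ (MvPolynomial (Fin n) ℝ))) (k : ℕ) : Prop :=
  ∀ j < θ.length, ∀ i ≤ k,
    ∀ γ ∈ tStressK Δ i ⊓ ⨅ l ∈ Finset.range j, LinearMap.ker (θ.getD l 0),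
      ∃ γ' ∈ tStressK Δ (i + 1) ⊓ ⨅ l ∈ Finset.range j, LinearMap.ker (θ.getD l 0),
        θ.getD j 0 γ' = γ

/-- `dim Δ + 1`: the maximal cardinality of a face. -/
noncomputable def dim1 {n : ℕ} (Δ : Set (Finset (Fin n))) : ℕ :=
  sSup {m | ∃ σ ∈ Δ, σ.card = m}

/-- `Δ` is Cohen–Macaulay over `ℝ`: the reduced homology of every face link vanishes below
the expected dimension. -/
def IsCM {n : ℕ} (Δ : Set (Finset (Fin n))) : Prop :=
  ∀ σ ∈ Δ, ∀ i : ℤ, i < (dim1 Δ : ℤ) - 1 - σ.card →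
    cycles (lk Δ σ) i ≤ bdries (lk Δ σ) i

/-- `(q, T)` is a triangulation of the simplicial polytope `P = conv{p i}` whose faces contained
in the boundary `∂P` form exactly the boundary complex `Δ` of `P`. -/
def IsTriangulation {n d m : ℕ} (p : Fin n → Fin d → ℝ) (Δ : Set (Finset (Fin n)))
    (q : Fin m → Fin d → ℝ) (T : Set (Finset (Fin m))) : Prop :=
  IsComplex T ∧
  (∀ σ ∈ T, AffineIndependent ℝ (fun i : {x // x ∈ σ} => q i.1)) ∧
  (∀ σ ∈ T, ∀ τ ∈ T,
    convexHull ℝ (q '' ↑σ) ∩ convexHull ℝ (q '' ↑τ) = convexHull ℝ (q '' ↑(σ ∩ τ))) ∧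
  (⋃ σ ∈ T, convexHull ℝ (q '' ↑σ)) = convexHull ℝ (Set.range p) ∧
  {s : Set (Fin d → ℝ) | ∃ σ ∈ T,
      convexHull ℝ (q '' ↑σ) ⊆ frontier (convexHull ℝ (Set.range p)) ∧ s = q '' ↑σ}
    = {s : Set (Fin d → ℝ) | ∃ σ ∈ Δ, s = p '' ↑σ}

/-- The restriction `Δ_S` of a balanced complex to the set `S` of colors. -/
def colorRestrict {n d : ℕ} (Δ : Set (Finset (Fin n))) (col : Fin n → Fin d)
    (S : Finset (Fin d)) : Set (Finset (Fin n)) :=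
  {σ ∈ Δ | ∀ v ∈ σ, col v ∈ S}

/-! ### Boundary basics -/

/-- The sign of the vertex `i` in `σ`. -/
noncomputable def sgn19 {n : ℕ} (σ : Finset (Fin n)) (i : Fin n) : ℝ :=
  (-1 : ℝ) ^ (σ.filter (· < i)).card

lemma bdry_single19 {n : ℕ} (σ : Finset (Fin n)) (r : ℝ) :
    bdry (Finsupp.single σ r) =
      r • ∑ i ∈ σ, sgn19 σ i • Finsupp.single (σ.erase i) (1 : ℝ) := by
  simp [bdry, sgn19]

lemma sgn19_erase_lt {n : ℕ} (σ : Finset (Fin n)) (i j : Fin n) (hi : i ∈ σ) (h : i < j) :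
    sgn19 (σ.erase i) j = - sgn19 σ j := by
  have : (σ.filter (· < j)).card = ((σ.erase i).filter (· < j)).card + 1 := by
    rw [Finset.filter_erase, Finset.card_erase_add_one]
    simp [hi, h]
  simp [sgn19, this, pow_succ]

lemma sgn19_erase_gt {n : ℕ} (σ : Finset (Fin n)) (i j : Fin n) (h : i < j) :
    sgn19 (σ.erase j) i = sgn19 σ i := by
  unfold sgn19
  rw [Finset.filter_erase, Finset.erase_eq_of_notMem]
  simp [h.le]

lemma sgn19_swap {n : ℕ} (σ : Finset (Fin n)) (i j : Fin n) (hi : i ∈ σ) (hj : j ∈ σ)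
    (h : i ≠ j) :
    sgn19 σ i * sgn19 (σ.erase i) j = - (sgn19 σ j * sgn19 (σ.erase j) i) := by
  rcases lt_or_gt_of_ne h with h | h
  · rw [sgn19_erase_lt σ i j hi h, sgn19_erase_gt σ i j h]; ring
  · rw [sgn19_erase_lt σ j i hj h, sgn19_erase_gt σ j i h]; ring

lemma bdry_bdry_single19 {n : ℕ} (σ : Finset (Fin n)) :
    bdry (bdry (Finsupp.single σ (1 : ℝ))) = 0 := by
  have e : bdry (bdry (Finsupp.single σ (1 : ℝ))) =
      ∑ i ∈ σ, ∑ j ∈ σ, if i = j then 0 else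
        (sgn19 σ i * sgn19 (σ.erase i) j) • Finsupp.single ((σ.erase i).erase j) (1 : ℝ) := by
    rw [bdry_single19, one_smul, map_sum]
    refine Finset.sum_congr rfl fun i hi => ?_
    rw [map_smul, bdry_single19, one_smul, Finset.smul_sum]
    rw [← Finset.add_sum_erase σ _ hi]
    simp only [if_true, zero_add]
    refine Finset.sum_congr rfl fun j hj => ?_
    rw [if_neg (Finset.ne_of_mem_erase hj).symm, smul_smul]
  have e2 : bdry (bdry (Finsupp.single σ (1 : ℝ))) =
      - bdry (bdry (Finsupp.single σ (1 : ℝ))) := by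
    conv_lhs => rw [e, Finset.sum_comm]
    rw [e, ← Finset.sum_neg_distrib]
    refine Finset.sum_congr rfl fun i hi => ?_
    rw [← Finset.sum_neg_distrib]
    refine Finset.sum_congr rfl fun j hj => ?_
    by_cases h : i = j
    · simp [h]
    · rw [if_neg h, if_neg (Ne.symm h), sgn19_swap σ j i hj hi (Ne.symm h),
        Finset.erase_right_comm, neg_smul]
  exact self_eq_neg.mp e2

lemma bdry_bdry19 {n : ℕ} (z : Finset (Fin n) →₀ ℝ) : bdry (bdry z) = 0 := by
  have : (bdry (n := n)) ∘ₗ bdry = 0 := by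
    ext σ : 2
    simpa using bdry_bdry_single19 σ
  exact LinearMap.congr_fun this z

/-- Chains of `X` on faces with `m` vertices. -/
noncomputable abbrev ch19 {n : ℕ} (X : Set (Finset (Fin n))) (m : ℕ) :
    Submodule ℝ (Finset (Fin n) →₀ ℝ) :=
  Finsupp.supported ℝ ℝ {σ | σ ∈ X ∧ σ.card = m}

lemma ch19_mono {n : ℕ} {X Y : Set (Finset (Fin n))} (h : X ⊆ Y) (m : ℕ) :
    ch19 X m ≤ ch19 Y m :=
  Finsupp.supported_mono fun _ hs => ⟨h hs.1, hs.2⟩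

lemma ch19_inf {n : ℕ} {X Y : Set (Finset (Fin n))} {m : ℕ} {z : Finset (Fin n) →₀ ℝ}
    (hX : z ∈ ch19 X m) (hY : z ∈ ch19 Y m) : z ∈ ch19 (X ∩ Y) m := by
  rw [Finsupp.mem_supported] at *
  exact fun s hs => ⟨⟨(hX hs).1, (hY hs).1⟩, (hX hs).2⟩

lemma bdry_mem19 {n : ℕ} {X : Set (Finset (Fin n))} (hX : IsComplex X) {m : ℕ}
    {z : Finset (Fin n) →₀ ℝ} (hz : z ∈ ch19 X (m + 1)) : bdry z ∈ ch19 X m := by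
  rw [← Finsupp.sum_single z, Finsupp.sum, map_sum]
  refine Submodule.sum_mem _ fun σ hσ => ?_
  have h := (Finsupp.mem_supported ℝ z).mp hz hσ
  rw [bdry_single19]
  refine Submodule.smul_mem _ _ (Submodule.sum_mem _ fun i hi => Submodule.smul_mem _ _ ?_)
  refine Finsupp.single_mem_supported ℝ _ ⟨hX σ h.1 _ (Finset.erase_subset _ _), ?_⟩
  rw [Finset.card_erase_of_mem hi, h.2]; rfl

/-- Homology vanishing at faces with `m` vertices. -/
def Van19 {n : ℕ} (X : Set (Finset (Fin n))) (m : ℕ) : Prop :=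
  ∀ z ∈ ch19 X m, bdry z = 0 → ∃ c ∈ ch19 X (m + 1), bdry c = z

lemma isComplex_induced19 {n : ℕ} {Δ : Set (Finset (Fin n))} (h : IsComplex Δ)
    (W : Finset (Fin n)) : IsComplex (induced Δ W) :=
  fun σ hσ τ hτ => ⟨h σ hσ.1 τ hτ, hτ.trans hσ.2⟩

/-! ### The Mayer–Vietoris step -/

lemma mayer19 {n : ℕ} {A B : Set (Finset (Fin n))} (hA : IsComplex A) (hB : IsComplex B)
    (m : ℕ) (vA : Van19 A (m + 1)) (vB : Van19 B (m + 1)) (vAB : Van19 (A ∩ B) m) :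
    Van19 (A ∪ B) (m + 1) := by
  classical
  intro z hz hz0
  set b := z.filter (fun s => s ∈ B) with hb
  set a := z.filter (fun s => ¬ s ∈ B) with ha
  have hab : b + a = z := Finsupp.filter_pos_add_filter_neg z _
  have hz' := (Finsupp.mem_supported ℝ z).mp hz
  have hbm : b ∈ ch19 B (m + 1) := by
    rw [Finsupp.mem_supported]
    intro s hs
    rw [hb, Finset.mem_coe, Finsupp.support_filter, Finset.mem_filter] at hs
    exact ⟨hs.2, (hz' hs.1).2⟩
  have ham : a ∈ ch19 A (m + 1) := by
    rw [Finsupp.mem_supported]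
    intro s hs
    rw [ha, Finset.mem_coe, Finsupp.support_filter, Finset.mem_filter] at hs
    exact ⟨(hz' hs.1).1.resolve_right hs.2, (hz' hs.1).2⟩
  have hs : bdry b + bdry a = 0 := by rw [← map_add, hab, hz0]
  have hbA : bdry b ∈ ch19 A m := by
    rw [eq_neg_of_add_eq_zero_left hs]
    exact Submodule.neg_mem _ (bdry_mem19 hA ham)
  obtain ⟨c, hc, hcb⟩ := vAB (bdry b) (ch19_inf hbA (bdry_mem19 hB hbm)) (bdry_bdry19 b)
  obtain ⟨d, hd, hdb⟩ := vB (b - c)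
    (Submodule.sub_mem _ hbm (ch19_mono Set.inter_subset_right _ hc)) (by
      rw [map_sub, hcb, sub_self])
  obtain ⟨e, he, heb⟩ := vA (a + c)
    (Submodule.add_mem _ ham (ch19_mono Set.inter_subset_left _ hc)) (by
      rw [map_add, hcb, add_comm, hs])
  refine ⟨d + e, Submodule.add_mem _ (ch19_mono Set.subset_union_right _ hd)
    (ch19_mono Set.subset_union_left _ he), ?_⟩
  rw [map_add, hdb, heb, ← hab]; abel

/-- Faces of `Δ_W` not containing `σ`. -/
def X19 {n : ℕ} (Δ : Set (Finset (Fin n))) (W σ : Finset (Fin n)) : Set (Finset (Fin n)) :=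
  {τ ∈ induced Δ W | ¬ σ ⊆ τ}

lemma isComplex_X19 {n : ℕ} {Δ : Set (Finset (Fin n))} (h : IsComplex Δ)
    (W σ : Finset (Fin n)) : IsComplex (X19 Δ W σ) :=
  fun ρ hρ τ hτ => ⟨isComplex_induced19 h W ρ hρ.1 τ hτ, fun hh => hρ.2 (hh.trans hτ)⟩

lemma X19_van {n : ℕ} {Δ : Set (Finset (Fin n))} (h : IsComplex Δ) (k : ℕ)
    (σ : Finset (Fin n)) : ∀ W : Finset (Fin n),
    (∀ τ ⊆ σ, τ.Nonempty → ∀ m, k < m → Van19 (induced Δ (W \ τ)) m) →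
    ∀ m, k + σ.card ≤ m → k < m → Van19 (X19 Δ W σ) m := by
  classical
  induction σ using Finset.induction_on with
  | empty =>
    intro W _ m _ _ z hz _
    refine ⟨0, Submodule.zero_mem _, ?_⟩
    have : z ∈ ch19 (∅ : Set (Finset (Fin n))) m :=
      ch19_mono (fun τ hτ => hτ.2 (Finset.empty_subset _)) m hz
    rw [Finsupp.mem_supported] at this
    have h0 : z.support = ∅ := by
      rw [Finset.eq_empty_iff_forall_notMem]
      exact fun s hs => (this hs).1
    rw [Finsupp.support_eq_empty.mp h0, map_zero]
  | insert v σ hv ih =>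
    intro W hW m hm hkm
    have hX : X19 Δ W (insert v σ) = X19 Δ W σ ∪ induced Δ (W \ {v}) := by
      ext τ
      simp only [X19, induced, Set.mem_setOf_eq, Set.mem_union, Finset.insert_subset_iff,
        Finset.subset_sdiff, Finset.disjoint_singleton_right]
      tauto
    have hI : X19 Δ W σ ∩ induced Δ (W \ {v}) = X19 Δ (W \ {v}) σ := by
      ext τ
      simp only [X19, induced, Set.mem_setOf_eq, Set.mem_inter_iff,
        Finset.subset_sdiff, Finset.disjoint_singleton_right]
      tauto
    rw [Finset.card_insert_of_notMem hv] at hm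
    have hvW := hW {v} (by simp) (by simp)
    obtain ⟨m, rfl⟩ : ∃ m', m = m' + 1 := ⟨m - 1, by omega⟩
    rcases σ.eq_empty_or_nonempty with rfl | hσ
    · have : X19 Δ W (insert v ∅) = induced Δ (W \ {v}) := by
        rw [hX]
        have : X19 Δ W ∅ = ∅ := by
          ext τ; simp [X19]
        rw [this, Set.empty_union]
      rw [this]
      exact hvW _ hkm
    rw [hX]
    have hc : 0 < σ.card := hσ.card_pos
    refine mayer19 (isComplex_X19 h _ _) (isComplex_induced19 h _) m ?_ (hvW _ hkm) ?_
    · exact ih W (fun τ hτ => hW τ (hτ.trans (Finset.subset_insert _ _))) _ (by omega) hkm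
    · rw [hI]
      refine ih (W \ {v}) (fun τ hτ hne => ?_) m (by omega) (by omega)
      rw [sdiff_sdiff_left]
      refine hW _ ?_ ?_
      · exact Finset.union_subset (by simp) (hτ.trans (Finset.subset_insert _ _))
      · exact Finset.Nonempty.mono Finset.subset_union_right hne

/-! ### The simplex is acyclic -/

/-- Cone operator with apex `v`. -/
noncomputable def cone19 {n : ℕ} (v : Fin n) :
    (Finset (Fin n) →₀ ℝ) →ₗ[ℝ] (Finset (Fin n) →₀ ℝ) :=
  Finsupp.lsum ℝ fun σ => LinearMap.toSpanSingleton ℝ _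
    (if v ∈ σ then 0 else Finsupp.single (insert v σ) (1 : ℝ))

lemma cone_single19 {n : ℕ} (v : Fin n) (σ : Finset (Fin n)) (r : ℝ) :
    cone19 v (Finsupp.single σ r) =
      r • (if v ∈ σ then 0 else Finsupp.single (insert v σ) (1 : ℝ)) := by
  simp [cone19]

lemma sgn19_min {n : ℕ} (v : Fin n) (σ : Finset (Fin n)) (h : ∀ i ∈ σ, v ≤ i) :
    sgn19 σ v = 1 := by
  have : σ.filter (· < v) = ∅ := by
    rw [Finset.filter_eq_empty_iff]
    exact fun i hi => not_lt.mpr (h i hi)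
  simp [sgn19, this]

lemma cone_homotopy19 {n : ℕ} (v : Fin n) (σ : Finset (Fin n)) (h : ∀ i ∈ σ, v ≤ i) :
    bdry (cone19 v (Finsupp.single σ (1 : ℝ))) + cone19 v (bdry (Finsupp.single σ (1 : ℝ))) =
      Finsupp.single σ 1 := by
  rw [bdry_single19, one_smul, map_sum, cone_single19, one_smul]
  by_cases hv : v ∈ σ
  · rw [if_pos hv, map_zero, zero_add, ← Finset.add_sum_erase σ _ hv, Finset.sum_eq_zero,
      add_zero, map_smul, cone_single19, sgn19_min v σ h]
    · simp [Finset.insert_erase hv]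
    · intro i hi
      rw [map_smul, cone_single19, if_pos]
      · simp
      · exact Finset.mem_erase.mpr ⟨(Finset.ne_of_mem_erase hi).symm, hv⟩
  · rw [if_neg hv, bdry_single19, one_smul, Finset.sum_insert hv, Finset.erase_insert hv,
      sgn19_min, one_smul, add_assoc, ← Finset.sum_add_distrib, Finset.sum_eq_zero, add_zero]
    · intro i hi
      have hne : v ≠ i := fun e => hv (e ▸ hi)
      have hlt : v < i := lt_of_le_of_ne (h i hi) hne
      have h1 := sgn19_erase_lt (insert v σ) v i (Finset.mem_insert_self _ _) hlt
      rw [Finset.erase_insert hv] at h1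
      rw [map_smul, cone_single19, if_neg (fun hh => hv (Finset.mem_of_mem_erase hh)), one_smul,
        h1, Finset.erase_insert_of_ne hne]
      simp
    · intro i hi
      rcases Finset.mem_insert.mp hi with rfl | hi
      · exact le_rfl
      · exact h i hi

lemma simplex_van19 {n : ℕ} {Δ : Set (Finset (Fin n))} (h : IsComplex Δ)
    (W : Finset (Fin n)) (hW : W ∈ Δ) (m : ℕ) (hm : 0 < m) : Van19 (induced Δ W) m := by
  intro z hz hz0
  have hz' := (Finsupp.mem_supported ℝ z).mp hz
  rcases W.eq_empty_or_nonempty with rfl | hne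
  · refine ⟨0, Submodule.zero_mem _, ?_⟩
    have h0 : z.support = ∅ := by
      rw [Finset.eq_empty_iff_forall_notMem]
      intro s hs
      have h1 := hz' hs
      have h2 := Finset.card_le_card h1.1.2
      have h3 := h1.2
      simp at h2
      subst h2
      simp at h3
      omega
    rw [Finsupp.support_eq_empty.mp h0, map_zero]
  · set v := W.min' hne with hv
    have hvW : v ∈ W := W.min'_mem hne
    refine ⟨cone19 v z, ?_, ?_⟩
    · rw [← Finsupp.sum_single z, Finsupp.sum, map_sum]
      refine Submodule.sum_mem _ fun σ hσ => ?_
      have h1 := hz' hσ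
      rw [cone_single19]
      refine Submodule.smul_mem _ _ ?_
      split_ifs with hvs
      · exact Submodule.zero_mem _
      · have hsub : insert v σ ⊆ W := Finset.insert_subset hvW h1.1.2
        refine Finsupp.single_mem_supported ℝ _ ⟨⟨h W hW _ hsub, hsub⟩, ?_⟩
        rw [Finset.card_insert_of_notMem hvs, h1.2]
    · have key : bdry (cone19 v z) + cone19 v (bdry z) = z := by
        have e : z = ∑ s ∈ z.support, z s • Finsupp.single s (1 : ℝ) := by
          conv_lhs => rw [← Finsupp.sum_single z, Finsupp.sum]
          simp
        conv_lhs => rw [e]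
        conv_rhs => rw [e]
        simp only [map_sum, map_smul]
        rw [← Finset.sum_add_distrib]
        refine Finset.sum_congr rfl fun s hs => ?_
        rw [← smul_add, cone_homotopy19]
        exact fun i hi => W.min'_le i ((hz' hs).1.2 hi)
      simpa [hz0] using key

/-! ### Translation to resolution chordality -/

lemma chains_eq19 {n : ℕ} (Δ : Set (Finset (Fin n))) (i : ℕ) :
    chains Δ (i : ℤ) = ch19 Δ (i + 1) := by
  unfold chains ch19
  congr 1
  ext s
  simp only [Set.mem_setOf_eq]
  refine and_congr_right fun _ => ?_
  omega

lemma chains_eq19' {n : ℕ} (Δ : Set (Finset (Fin n))) (i : ℕ) :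
    chains Δ ((i : ℤ) + 1) = ch19 Δ (i + 1 + 1) := by
  rw [← chains_eq19]; push_cast; rfl

lemma mem_chainVerts19 {n : ℕ} {z : Finset (Fin n) →₀ ℝ} {s : Finset (Fin n)}
    (hs : s ∈ z.support) : s ⊆ chainVerts z :=
  Finset.subset_biUnion_of_mem id hs

lemma ch19_induced_iff {n : ℕ} {Δ : Set (Finset (Fin n))} {W : Finset (Fin n)} {m : ℕ}
    {z : Finset (Fin n) →₀ ℝ} :
    z ∈ ch19 (induced Δ W) m ↔ z ∈ ch19 Δ m ∧ chainVerts z ⊆ W := by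
  constructor
  · intro h
    refine ⟨ch19_mono (fun s hs => hs.1) m h, ?_⟩
    exact Finset.biUnion_subset.mpr fun s hs => ((Finsupp.mem_supported ℝ z).mp h hs).1.2
  · rintro ⟨h, hW⟩
    rw [Finsupp.mem_supported] at *
    exact fun s hs => ⟨⟨(h hs).1, (mem_chainVerts19 hs).trans hW⟩, (h hs).2⟩

lemma chordal_iff19 {n : ℕ} {Δ : Set (Finset (Fin n))} (h : IsComplex Δ) (i : ℕ) :
    ResolutionChordal Δ (i : ℤ) ↔ ∀ W, Van19 (induced Δ W) (i + 1) := by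
  unfold ResolutionChordal cycles
  rw [chains_eq19, chains_eq19']
  constructor
  · intro H W z hz hz0
    rw [ch19_induced_iff] at hz
    obtain ⟨c, hc, hcz, hv⟩ := H z ⟨hz.1, hz0⟩
    exact ⟨c, ch19_induced_iff.mpr ⟨hc, hv ▸ hz.2⟩, hcz⟩
  · rintro H z ⟨hz, hz0⟩
    obtain ⟨c, hc, hcz⟩ := H (chainVerts z) z (ch19_induced_iff.mpr ⟨hz, subset_rfl⟩) hz0
    have hc' := ch19_induced_iff.mp hc
    refine ⟨c, hc'.1, hcz, subset_antisymm hc'.2 ?_⟩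
    have h1 : c ∈ ch19 (induced Δ (chainVerts c)) (i + 1 + 1) :=
      ch19_induced_iff.mpr ⟨hc'.1, subset_rfl⟩
    have h2 := bdry_mem19 (isComplex_induced19 h _) h1
    rw [hcz] at h2
    exact (ch19_induced_iff.mp h2).2

lemma exists_missing19 {n : ℕ} (Δ : Set (Finset (Fin n))) (W : Finset (Fin n)) :
    W ∉ Δ → ∃ σ ⊆ W, IsMissingFace Δ σ := by
  induction W using Finset.strongInduction with
  | H W ih =>
    intro hW
    by_cases hc : ∀ τ ⊂ W, τ ∈ Δ
    · exact ⟨W, subset_rfl, hW, hc⟩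
    · push Not at hc
      obtain ⟨τ, hτ, hτΔ⟩ := hc
      obtain ⟨σ, hσ, hh⟩ := ih τ hτ hτΔ
      exact ⟨σ, hσ.trans hτ.1, hh⟩

theorem stmt19 {n : ℕ} (Δ : Set (Finset (Fin n))) (hΔ : IsComplex Δ) (k : ℕ) (hk : 1 ≤ k)
    (hm : ∀ σ : Finset (Fin n), IsMissingFace Δ σ → σ.card ≤ k + 1) :
    (∀ i : ℕ, k ≤ i → i ≤ 2 * k - 1 → ResolutionChordal Δ (i : ℤ)) ↔
    (∀ i : ℕ, k ≤ i → ResolutionChordal Δ (i : ℤ)) := by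
  refine ⟨fun H => ?_, fun H i hi _ => H i hi⟩
  have main : ∀ W : Finset (Fin n), ∀ m, k < m → Van19 (induced Δ W) m := by
    intro W
    induction W using Finset.strongInduction with
    | H W ih =>
      intro m hkm
      by_cases hsmall : m ≤ 2 * k
      · have h1 := (chordal_iff19 hΔ (m - 1)).mp (H (m - 1) (by omega) (by omega)) W
        rwa [Nat.sub_add_cancel (by omega)] at h1
      by_cases hW : W ∈ Δ
      · exact simplex_van19 hΔ W hW m (by omega)
      obtain ⟨σ, hσW, hσ⟩ := exists_missing19 Δ W hW
      have hX : induced Δ W = X19 Δ W σ := by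
        ext τ
        simp only [X19, Set.mem_setOf_eq]
        refine ⟨fun h => ⟨h, fun hs => hσ.1 (hΔ τ h.1 σ hs)⟩, fun h => h.1⟩
      rw [hX]
      have hc := hm σ hσ
      refine X19_van hΔ k σ W (fun τ hτ hne m' hm' => ?_) m (by omega) hkm
      exact ih _ (Finset.sdiff_ssubset (hτ.trans hσW) hne) m' hm'
  intro i hi
  rw [chordal_iff19 hΔ i]
  exact fun W => main W (i + 1) (by omega)
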